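/- In SL(2,ℤ), the identity cannot be factorized as a product of fewer than 12 positive Dehn twists; precisely, if n ≥ 1 and M₁, …, Mₙ ∈ SL(2,ℤ) are each conjugate to V (i.e. Mᵢ = gᵢ·V·gᵢ⁻¹ for some gᵢ ∈ SL(2,ℤ)), and M₁·M₂·⋯·Mₙ = 1, then 12 divides n. -/

import Mathlib

open Matrix

/-- `V = [[1,1],[0,1]]`, a positive Dehn twist along a cycle of the torus. -/
def V : SpecialLinearGroup (Fin 2) ℤ :=
  ⟨!![1, 1; 0, 1], by norm_num [Matrix.det_fin_two_of]⟩

/-- A polynomial in the entries of `!![a, b; c, d]` which, over `ZMod 3` and `ZMod 4`, is additive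
on matrices of determinant one and takes the value `1` on `!![1, 1; 0, 1]`. -/
def twistPoly {R : Type*} [CommRing R] (a b c d : R) : R :=
  (1 - c ^ 2) * (b * d + 3 * (c - 1) * d + c + 3) + c * (a + d - 3)

/-- Additivity of `twistPoly` on matrices of determinant one with entries in `R`. -/
def TwistPolyAdditive (R : Type*) [CommRing R] : Prop :=
  ∀ a b c d : R, a * d - b * c = 1 → ∀ p q r s : R, p * s - q * r = 1 →
    twistPoly (a * p + b * r) (a * q + b * s) (c * p + d * r) (c * q + d * s) =
      twistPoly a b c d + twistPoly p q r s

theorem twistPolyAdditive_zmod_three : TwistPolyAdditive (ZMod 3) := by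
  unfold TwistPolyAdditive twistPoly
  decide +kernel

theorem twistPolyAdditive_zmod_four : TwistPolyAdditive (ZMod 4) := by
  unfold TwistPolyAdditive twistPoly
  decide +kernel

/-- The homomorphism from `SL(2, ℤ)` to the additive group of `R` given by `twistPoly`. -/
def TwistPolyAdditive.toHom {R : Type*} [CommRing R] (h : TwistPolyAdditive R) :
    SpecialLinearGroup (Fin 2) ℤ →* Multiplicative R where
  toFun A := .ofAdd (twistPoly (A 0 0 : R) (A 0 1) (A 1 0) (A 1 1))
  map_one' := by simp [twistPoly]
  map_mul' A B := by
    have det_cast (C : SpecialLinearGroup (Fin 2) ℤ) :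
        (C 0 0 : R) * C 1 1 - C 0 1 * C 1 0 = 1 := by
      have hC := C.det_coe
      rw [det_fin_two] at hC
      exact_mod_cast congrArg (Int.cast : ℤ → R) hC
    rw [← ofAdd_add, ← h _ _ _ _ (det_cast A) _ _ _ _ (det_cast B)]
    simp [mul_apply, Fin.sum_univ_two]

theorem TwistPolyAdditive.toHom_V {R : Type*} [CommRing R] (h : TwistPolyAdditive R) :
    h.toHom V = .ofAdd 1 := by
  simp [toHom, twistPoly, V]

/-- The image of a product of `n` conjugates of `V` in a commutative group is the `n`-th power of
the image of `V`. -/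
theorem map_prod_ofFn_conj_V {G : Type*} [CommGroup G]
    (f : SpecialLinearGroup (Fin 2) ℤ →* G) {n : ℕ}
    {M : Fin n → SpecialLinearGroup (Fin 2) ℤ}
    (hM : ∀ i, ∃ g : SpecialLinearGroup (Fin 2) ℤ, M i = g * V * g⁻¹) :
    f (List.ofFn M).prod = f V ^ n := by
  have hf (i : Fin n) : f (M i) = f V := by
    obtain ⟨g, hg⟩ := hM i
    simp [hg]
  simp [map_list_prod, List.map_ofFn, Function.comp_def, hf]

theorem TwistPolyAdditive.natCast_eq_zero {R : Type*} [CommRing R] (h : TwistPolyAdditive R)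
    {n : ℕ} {M : Fin n → SpecialLinearGroup (Fin 2) ℤ}
    (hM : ∀ i, ∃ g : SpecialLinearGroup (Fin 2) ℤ, M i = g * V * g⁻¹)
    (hprod : (List.ofFn M).prod = 1) : (n : R) = 0 := by
  have key := map_prod_ofFn_conj_V h.toHom hM
  rw [hprod, map_one, h.toHom_V, ← ofAdd_nsmul, nsmul_one] at key
  exact ofAdd_eq_one.mp key.symm

/-- If `n ≥ 1` and `M₁, …, Mₙ ∈ SL(2,ℤ)` are each conjugate to `V` and their ordered
product is the identity, then `12 ∣ n`: the identity cannot be factorized into fewer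
than 12 positive Dehn twists. -/
theorem twelve_divides_twist_factorization (n : ℕ) (hn : 1 ≤ n)
    (M : Fin n → SpecialLinearGroup (Fin 2) ℤ)
    (hconj : ∀ i, ∃ g : SpecialLinearGroup (Fin 2) ℤ, M i = g * V * g⁻¹)
    (hprod : (List.ofFn M).prod = 1) : 12 ∣ n := by
  have h3 : 3 ∣ n := (ZMod.natCast_eq_zero_iff n 3).mp
    (twistPolyAdditive_zmod_three.natCast_eq_zero hconj hprod)
  have h4 : 4 ∣ n := (ZMod.natCast_eq_zero_iff n 4).mp
    (twistPolyAdditive_zmod_four.natCast_eq_zero hconj hprod)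
  lia
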